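/- arXiv:2310.13197 — 7 statements merged into one kernel-verified Lean document; each statement's English description precedes it below -/
import Mathlib

section
/- Let I ⊆ ℝ be an open interval and let α, β ∈ ℝ with β ≠ 0. Let u : I × ℝ² → ℝ be a smooth function satisfying the SU(∞) Toda equation ∂²(e^u)/∂ϱ² + ∂²u/∂x² + ∂²u/∂y² = 0 and doubly periodic in (x, y) with periods (1, 0) and (α, β), i.e. u(ϱ, x+1, y) = u(ϱ, x, y) and u(ϱ, x+α, y+β) = u(ϱ, x, y) for all (ϱ, x, y). Then there exist constants a, b ∈ ℝ such that for every ϱ ∈ I, ∫₀¹∫₀¹ e^{u(ϱ, s+tα, tβ)} |β| ds dt = aϱ + b; that is, the integral of e^u over a fundamental domain of the period lattice is an affine function of ϱ. -/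
open Set Real

open MeasureTheory Topology

/-- Directional derivatives of a smooth function on an open set are smooth. -/
lemma ContDiffOn.fderiv_apply_const {E : Type*} [NormedAddCommGroup E] [NormedSpace ℝ E]
    {s : Set E} (hs : IsOpen s) {f : E → ℝ} (hf : ContDiffOn ℝ (⊤ : ℕ∞) f s) (v : E) :
    ContDiffOn ℝ (⊤ : ℕ∞) (fun p => fderiv ℝ f p v) s :=
  (hf.fderiv_of_isOpen hs (by norm_cast)).clm_apply contDiffOn_const

/-- A directional derivative inherits the periods of the function. -/
lemma fderiv_apply_periodic {E : Type*} [NormedAddCommGroup E] [NormedSpace ℝ E]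
    {s : Set E} (hs : IsOpen s) {f : E → ℝ} {w : E} (hf : ∀ p ∈ s, f (p + w) = f p) (v : E) :
    ∀ p ∈ s, fderiv ℝ f (p + w) v = fderiv ℝ f p v := by
  intro p hp
  have h : (fun q => f (q + w)) =ᶠ[𝓝 p] f := by
    filter_upwards [hs.mem_nhds hp] with q hq using hf q hq
  rw [← fderiv_comp_add_right, h.fderiv_eq]

/-- Differentiation under the integral sign, over a compact set of parameters. -/
lemma hasDerivAt_setIntegral_of_contDiffOn {I : Set ℝ} (hI : IsOpen I)
    {E : Type*} [NormedAddCommGroup E] [NormedSpace ℝ E] {f : ℝ × E → ℝ}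
    (hf : ContDiffOn ℝ (⊤ : ℕ∞) f (I ×ˢ univ)) {L : ℝ × ℝ → E} (hL : Continuous L)
    {K : Set (ℝ × ℝ)} (hK : IsCompact K) {r₀ : ℝ} (hr₀ : r₀ ∈ I) :
    HasDerivAt (fun r => ∫ z in K, f (r, L z))
      (∫ z in K, fderiv ℝ f (r₀, L z) (1, 0)) r₀ := by
  have hΩ : IsOpen (I ×ˢ (univ : Set E)) := hI.prod isOpen_univ
  have hf' := hf.fderiv_apply_const hΩ ((1, 0) : ℝ × E)
  have slice : ∀ {g : ℝ × E → ℝ}, ContinuousOn g (I ×ˢ univ) → ∀ r ∈ I,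
      Continuous fun z => g (r, L z) := fun hg r hr =>
    hg.comp_continuous (by fun_prop) fun z => ⟨hr, mem_univ _⟩
  obtain ⟨ε, hε, hball⟩ := Metric.nhds_basis_closedBall.mem_iff.1 (hI.mem_nhds hr₀)
  have hcomp : IsCompact (Metric.closedBall r₀ ε ×ˢ K) := (isCompact_closedBall r₀ ε).prod hK
  obtain ⟨C, hC⟩ := hcomp.exists_bound_of_continuousOn
    (f := fun q : ℝ × (ℝ × ℝ) => fderiv ℝ f (q.1, L q.2) (1, 0))
    (hf'.continuousOn.comp (by fun_prop) fun q hq => ⟨hball hq.1, mem_univ _⟩)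
  refine (hasDerivAt_integral_of_dominated_loc_of_deriv_le (bound := fun _ => C)
    (F := fun r z => f (r, L z)) (F' := fun r z => fderiv ℝ f (r, L z) (1, 0))
    (Metric.closedBall_mem_nhds r₀ hε) ?_ ?_ ?_ ?_ ?_ ?_).2
  · filter_upwards [hI.mem_nhds hr₀] with r hr
    exact (slice hf.continuousOn r hr).aestronglyMeasurable
  · exact (slice hf.continuousOn r₀ hr₀).continuousOn.integrableOn_compact hK
  · exact (slice hf'.continuousOn r₀ hr₀).aestronglyMeasurable
  · filter_upwards [ae_restrict_mem hK.measurableSet] with z hz r hr using hC (r, z) ⟨hr, hz⟩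
  · exact continuousOn_const.integrableOn_compact hK
  · refine Filter.Eventually.of_forall fun z r hr => ?_
    have hd : DifferentiableAt ℝ f (r, L z) :=
      (hf.contDiffAt (hΩ.mem_nhds ⟨hball hr, mem_univ _⟩)).differentiableAt (by simp)
    exact hd.hasFDerivAt.comp_hasDerivAt r ((hasDerivAt_id r).prodMk (hasDerivAt_const r (L z)))

/-- An iterated integral of a continuous function over the unit square as a set integral. -/
lemma intervalIntegral_intervalIntegral_eq_setIntegral {h : ℝ × ℝ → ℝ} (hh : Continuous h) :
    ∫ t in (0:ℝ)..1, ∫ s in (0:ℝ)..1, h (t, s)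
      = ∫ z in Icc (0:ℝ) 1 ×ˢ Icc (0:ℝ) 1, h z := by
  rw [Measure.volume_eq_prod, setIntegral_prod _
    (hh.continuousOn.integrableOn_compact (isCompact_Icc.prod isCompact_Icc))]
  simp only [intervalIntegral.integral_of_le zero_le_one, integral_Icc_eq_integral_Ioc]

/-- The integral over the unit square of the derivative of a function periodic in the second
variable vanishes. -/
lemma setIntegral_eq_zero_of_hasDerivAt_snd {g g' : ℝ × ℝ → ℝ} (hg' : Continuous g')
    (hd : ∀ t s, HasDerivAt (fun s => g (t, s)) (g' (t, s)) s)
    (hper : ∀ t, g (t, 1) = g (t, 0)) :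
    ∫ z in Icc (0:ℝ) 1 ×ˢ Icc (0:ℝ) 1, g' z = 0 := by
  rw [← intervalIntegral_intervalIntegral_eq_setIntegral hg']
  have h : ∀ t, ∫ s in (0:ℝ)..1, g' (t, s) = 0 := fun t => by
    rw [intervalIntegral.integral_eq_sub_of_hasDerivAt (fun s _ => hd t s)
      (Continuous.intervalIntegrable (by fun_prop) _ _), hper, sub_self]
  simp [h]

/-- The integral over the unit square of the derivative of a function periodic in the first
variable vanishes. -/
lemma setIntegral_eq_zero_of_hasDerivAt_fst {g g' : ℝ × ℝ → ℝ} (hg' : Continuous g')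
    (hd : ∀ t s, HasDerivAt (fun t => g (t, s)) (g' (t, s)) t)
    (hper : ∀ s, g (1, s) = g (0, s)) :
    ∫ z in Icc (0:ℝ) 1 ×ˢ Icc (0:ℝ) 1, g' z = 0 := by
  have h := setIntegral_eq_zero_of_hasDerivAt_snd (g := g ∘ Prod.swap) (g' := g' ∘ Prod.swap)
    (hg'.comp continuous_swap) (fun t s => hd s t) hper
  rw [Measure.volume_eq_prod] at h ⊢
  rw [← setIntegral_prod_swap]
  exact h

/-- A function on an open interval whose second derivative vanishes is affine. -/
lemma exists_affine_of_hasDerivAt_of_hasDerivAt_zero {I : Set ℝ} (hI : IsOpen I)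
    (hconn : I.OrdConnected) {F G : ℝ → ℝ} (hF : ∀ r ∈ I, HasDerivAt F (G r) r)
    (hG : ∀ r ∈ I, HasDerivAt G 0 r) : ∃ a b : ℝ, ∀ r ∈ I, F r = a * r + b := by
  have hpre : IsPreconnected I := isPreconnected_iff_ordConnected.2 hconn
  obtain ⟨a, ha⟩ := hI.exists_is_const_of_deriv_eq_zero hpre
    (fun r hr => (hG r hr).differentiableAt.differentiableWithinAt) (fun r hr => (hG r hr).deriv)
  have hlin : ∀ r ∈ I, HasDerivAt (fun r => F r - a * r) 0 r := fun r hr => by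
    have h : HasDerivAt (fun r => F r - a * r) (G r - a * 1) r :=
      (hF r hr).sub ((hasDerivAt_id r).const_mul a)
    rwa [ha r hr, mul_one, sub_self] at h
  obtain ⟨b, hb⟩ := hI.exists_is_const_of_deriv_eq_zero hpre
    (fun r hr => (hlin r hr).differentiableAt.differentiableWithinAt)
    (fun r hr => (hlin r hr).deriv)
  exact ⟨a, b, fun r hr => by linarith [hb r hr]⟩

/-- A second derivative along a curve of constant velocity is an iterated directional
derivative. -/
lemma deriv_deriv_comp_eq_fderiv_fderiv {E : Type*} [NormedAddCommGroup E] [NormedSpace ℝ E]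
    {s : Set E} (hs : IsOpen s) {f : E → ℝ} (hf : ContDiffOn ℝ (⊤ : ℕ∞) f s) {c : ℝ → E} {v : E}
    (hc : ∀ r, HasDerivAt c v r) {r₀ : ℝ} (hr₀ : c r₀ ∈ s) :
    deriv (fun r => deriv (fun r' => f (c r')) r) r₀
      = fderiv ℝ (fun p => fderiv ℝ f p v) (c r₀) v := by
  have key : ∀ {g : E → ℝ}, ContDiffOn ℝ (⊤ : ℕ∞) g s → ∀ r, c r ∈ s →
      deriv (fun r' => g (c r')) r = fderiv ℝ g (c r) v := fun hg r hr =>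
    (((hg.contDiffAt (hs.mem_nhds hr)).differentiableAt (by simp)).hasFDerivAt.comp_hasDerivAt r
      (hc r)).deriv
  have hev : (fun r => deriv (fun r' => f (c r')) r) =ᶠ[𝓝 r₀] fun r => fderiv ℝ f (c r) v := by
    filter_upwards [(hc r₀).continuousAt (hs.mem_nhds hr₀)] with r hr using key hf r hr
  rw [hev.deriv_eq, key (hf.fderiv_apply_const hs v) r₀ hr₀]

/-- **The fundamental-domain integral of `e^u` is affine in `ϱ` (torus case).**
If `u` is a smooth solution of the `SU(∞)` Toda equation
`∂²(e^u)/∂ϱ² + ∂²u/∂x² + ∂²u/∂y² = 0` on `I × ℝ²` (with `I ⊆ ℝ` an open interval),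
doubly periodic in `(x, y)` with periods `(1, 0)` and `(α, β)` (`β ≠ 0`), then there are
constants `a, b` so that for every `ϱ ∈ I`,
`∫₀¹∫₀¹ e^{u(ϱ, s+tα, tβ)} |β| ds dt = aϱ + b`. -/
theorem toda_torus_integral_affine
    (I : Set ℝ) (hIopen : IsOpen I) (hIconn : I.OrdConnected)
    (α β : ℝ) (hβ : β ≠ 0) (u : ℝ → ℝ → ℝ → ℝ)
    (hsmooth : ContDiffOn ℝ (⊤ : ℕ∞) (fun p : ℝ × ℝ × ℝ => u p.1 p.2.1 p.2.2)
      (I ×ˢ (univ : Set (ℝ × ℝ))))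
    (htoda : ∀ ϱ ∈ I, ∀ x y : ℝ,
      deriv (fun r => deriv (fun r' => Real.exp (u r' x y)) r) ϱ
        + deriv (fun s => deriv (fun s' => u ϱ s' y) s) x
        + deriv (fun t => deriv (fun t' => u ϱ x t') t) y = 0)
    (hper : ∀ ϱ ∈ I, ∀ x y : ℝ,
      u ϱ (x + 1) y = u ϱ x y ∧ u ϱ (x + α) (y + β) = u ϱ x y) :
    ∃ a b : ℝ, ∀ ϱ ∈ I,
      (∫ t in (0:ℝ)..1, ∫ s in (0:ℝ)..1, Real.exp (u ϱ (s + t * α) (t * β)) * |β|)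
        = a * ϱ + b := by
  set Ω : Set (ℝ × ℝ × ℝ) := I ×ˢ univ
  have hΩ : IsOpen Ω := hIopen.prod isOpen_univ
  set U : ℝ × ℝ × ℝ → ℝ := fun p => u p.1 p.2.1 p.2.2 with hU
  set K : Set (ℝ × ℝ) := Icc (0:ℝ) 1 ×ˢ Icc (0:ℝ) 1
  have hK : IsCompact K := isCompact_Icc.prod isCompact_Icc
  set L : ℝ × ℝ → ℝ × ℝ := fun z => (z.2 + z.1 * α, z.1 * β) with hLdef
  have hL : Continuous L := by fun_prop
  have hE : ContDiffOn ℝ (⊤ : ℕ∞) (fun p => Real.exp (U p)) Ω := hsmooth.exp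
  have hD (v) := hE.fderiv_apply_const hΩ v
  have hP := hsmooth.fderiv_apply_const hΩ ((0, 1, 0) : ℝ × ℝ × ℝ)
  have hQ := hsmooth.fderiv_apply_const hΩ ((0, 0, 1) : ℝ × ℝ × ℝ)
  set P : ℝ × ℝ × ℝ → ℝ := fun p => fderiv ℝ U p (0, 1, 0)
  set Q : ℝ × ℝ × ℝ → ℝ := fun p => fderiv ℝ U p (0, 0, 1)
  have hper₁ : ∀ p ∈ Ω, U (p + (0, 1, 0)) = U p := fun p hp => by
    simpa [hU] using (hper p.1 hp.1 p.2.1 p.2.2).1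
  have hper₂ : ∀ p ∈ Ω, U (p + (0, α, β)) = U p := fun p hp => by
    simpa [hU] using (hper p.1 hp.1 p.2.1 p.2.2).2
  have slice : ∀ {g : ℝ × ℝ × ℝ → ℝ}, ContinuousOn g Ω → ∀ r ∈ I,
      Continuous fun z => g (r, L z) := fun hg r hr =>
    hg.comp_continuous (by fun_prop) fun z => ⟨hr, mem_univ _⟩
  have int_x : ∀ {A : ℝ × ℝ × ℝ → ℝ}, ContDiffOn ℝ (⊤ : ℕ∞) A Ω →
      (∀ p ∈ Ω, A (p + (0, 1, 0)) = A p) → ∀ r ∈ I,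
      ∫ z in K, fderiv ℝ A (r, L z) (0, 1, 0) = 0 := by
    intro A hA hAp r hr
    refine setIntegral_eq_zero_of_hasDerivAt_snd (g := fun z => A (r, L z))
      (slice (hA.fderiv_apply_const hΩ _).continuousOn r hr) (fun t s => ?_) fun t => ?_
    · have hd := (hA.contDiffAt (hΩ.mem_nhds (x := (r, L (t, s)))
        ⟨hr, mem_univ _⟩)).differentiableAt (by simp)
      exact hd.hasFDerivAt.comp_hasDerivAt s ((hasDerivAt_const s r).prodMk
        (((hasDerivAt_id s).add_const (t * α)).prodMk (hasDerivAt_const s (t * β))))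
    · rw [← hAp (r, L (t, 0)) ⟨hr, mem_univ _⟩]
      simp [hLdef, add_comm]
  have int_lattice : ∀ {A : ℝ × ℝ × ℝ → ℝ}, ContDiffOn ℝ (⊤ : ℕ∞) A Ω →
      (∀ p ∈ Ω, A (p + (0, α, β)) = A p) → ∀ r ∈ I,
      ∫ z in K, fderiv ℝ A (r, L z) (0, α, β) = 0 := by
    intro A hA hAp r hr
    refine setIntegral_eq_zero_of_hasDerivAt_fst (g := fun z => A (r, L z))
      (slice (hA.fderiv_apply_const hΩ _).continuousOn r hr) (fun t s => ?_) fun s => ?_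
    · have hd := (hA.contDiffAt (hΩ.mem_nhds (x := (r, L (t, s)))
        ⟨hr, mem_univ _⟩)).differentiableAt (by simp)
      have hc : HasDerivAt (fun t : ℝ => (r, L (t, s))) ((0, α, β) : ℝ × ℝ × ℝ) t := by
        refine (hasDerivAt_const t r).prodMk (HasDerivAt.prodMk ?_ ?_)
        · simpa using ((hasDerivAt_id t).mul_const α).const_add s
        · simpa using (hasDerivAt_id t).mul_const β
      exact hd.hasFDerivAt.comp_hasDerivAt t hc
    · rw [← hAp (r, L (0, s)) ⟨hr, mem_univ _⟩]
      simp [hLdef]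
  have toda : ∀ p ∈ Ω,
      fderiv ℝ (fun q => fderiv ℝ (fun p => Real.exp (U p)) q (1, 0)) p (1, 0)
        = (α / β) * fderiv ℝ Q p (0, 1, 0) - fderiv ℝ P p (0, 1, 0)
          - β⁻¹ * fderiv ℝ Q p (0, α, β) := by
    rintro ⟨r, x, y⟩ hp
    have h := htoda r hp.1 x y
    have h₁ := deriv_deriv_comp_eq_fderiv_fderiv hΩ hE (c := fun r => (r, x, y)) (v := (1, 0))
      (fun r => (hasDerivAt_id r).prodMk (hasDerivAt_const r (x, y))) hp
    have h₂ := deriv_deriv_comp_eq_fderiv_fderiv hΩ hsmooth (c := fun s => (r, s, y))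
      (v := (0, 1, 0)) (fun s => (hasDerivAt_const s r).prodMk
        ((hasDerivAt_id s).prodMk (hasDerivAt_const s y))) hp
    have h₃ := deriv_deriv_comp_eq_fderiv_fderiv hΩ hsmooth (c := fun t => (r, x, t))
      (v := (0, 0, 1)) (fun t => (hasDerivAt_const t r).prodMk
        ((hasDerivAt_const t x).prodMk (hasDerivAt_id t))) hp
    have hv : ((0, α, β) : ℝ × ℝ × ℝ) = α • (0, 1, 0) + β • (0, 0, 1) := by simp
    have hQv : fderiv ℝ Q (r, x, y) (0, α, β)
        = α * fderiv ℝ Q (r, x, y) (0, 1, 0) + β * fderiv ℝ Q (r, x, y) (0, 0, 1) := by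
      rw [hv, map_add, map_smul, map_smul, smul_eq_mul, smul_eq_mul]
    simp only [hU] at h₁ h₂ h₃
    rw [h₁, h₂, h₃] at h
    rw [hQv, mul_add, inv_mul_cancel_left₀ hβ]
    linear_combination h
  have int_toda : ∀ r ∈ I, ∫ z in K,
      fderiv ℝ (fun q => fderiv ℝ (fun p => Real.exp (U p)) q (1, 0)) (r, L z) (1, 0) = 0 := by
    intro r hr
    have hint : ∀ {A : ℝ × ℝ × ℝ → ℝ}, ContDiffOn ℝ (⊤ : ℕ∞) A Ω → ∀ v,
        Integrable (fun z => fderiv ℝ A (r, L z) v) (volume.restrict K) := fun hA v =>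
      (slice (hA.fderiv_apply_const hΩ v).continuousOn r hr).continuousOn.integrableOn_compact hK
    simp_rw [fun z => toda (r, L z) ⟨hr, mem_univ _⟩]
    have hdiff : Integrable (fun z => (α / β) * fderiv ℝ Q (r, L z) (0, 1, 0)
        - fderiv ℝ P (r, L z) (0, 1, 0)) (volume.restrict K) :=
      ((hint hQ _).const_mul _).sub (hint hP _)
    rw [integral_sub hdiff ((hint hQ _).const_mul _),
      integral_sub ((hint hQ _).const_mul _) (hint hP _), integral_const_mul, integral_const_mul,
      int_x hQ (fderiv_apply_periodic hΩ hper₁ _) r hr,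
      int_x hP (fderiv_apply_periodic hΩ hper₁ _) r hr,
      int_lattice hQ (fderiv_apply_periodic hΩ hper₂ _) r hr]
    simp
  obtain ⟨a, b, hab⟩ := exists_affine_of_hasDerivAt_of_hasDerivAt_zero hIopen hIconn
    (fun r hr => hasDerivAt_setIntegral_of_contDiffOn hIopen hE hL hK hr)
    (fun r hr => int_toda r hr ▸ hasDerivAt_setIntegral_of_contDiffOn hIopen (hD _) hL hK hr)
  refine ⟨a * |β|, b * |β|, fun r hr => ?_⟩
  have h := intervalIntegral_intervalIntegral_eq_setIntegral (slice hE.continuousOn r hr)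
  rw [hab r hr] at h
  simp only [intervalIntegral.integral_mul_const]
  linear_combination |β| * h
end

section
/- Let I ⊆ ℝ be an open interval and let α, β ∈ ℝ with β ≠ 0. Let u : I × ℝ² → ℝ be a smooth function satisfying the SU(∞) Toda equation ∂²(e^u)/∂ϱ² + ∂²u/∂x² + ∂²u/∂y² = 0 and doubly periodic in (x, y) with periods (1, 0) and (α, β). Suppose a, b ∈ ℝ are constants such that ∫₀¹∫₀¹ e^{u(ϱ, s+tα, tβ)} |β| ds dt = aϱ + b for every ϱ ∈ I. Then for every ϱ ∈ I, ∫₀¹∫₀¹ (−12ϱ + 6ϱ² ∂u/∂ϱ(ϱ, s+tα, tβ)) e^{u(ϱ, s+tα, tβ)} |β| ds dt = −6aϱ² − 12bϱ. -/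
open Set Real

open MeasureTheory Topology

/-- Differentiation under the integral sign over a compact set, for an integrand whose derivative
in the parameter is jointly continuous. -/
theorem hasDerivAt_setIntegral_of_isCompact {X : Type*} [TopologicalSpace X] [T2Space X]
    [SecondCountableTopology X] [MeasurableSpace X] [BorelSpace X]
    {μ : Measure X} [IsFiniteMeasureOnCompacts μ] {K : Set X} (hK : IsCompact K)
    {I : Set ℝ} (hI : IsOpen I) {F F' : ℝ → X → ℝ}
    (hF : ∀ r ∈ I, ContinuousOn (F r) K)
    (hF' : ContinuousOn (fun p : ℝ × X => F' p.1 p.2) (I ×ˢ K))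
    (hderiv : ∀ r ∈ I, ∀ x ∈ K, HasDerivAt (fun r => F r x) (F' r x) r)
    {r₀ : ℝ} (hr₀ : r₀ ∈ I) :
    HasDerivAt (fun r => ∫ x in K, F r x ∂μ) (∫ x in K, F' r₀ x ∂μ) r₀ := by
  obtain ⟨ε, hε, hball⟩ := Metric.nhds_basis_closedBall.mem_iff.1 (hI.mem_nhds hr₀)
  obtain ⟨C, hC⟩ := ((isCompact_closedBall r₀ ε).prod hK).exists_bound_of_continuousOn
    (hF'.mono (prod_mono_left hball))
  have hF'₀ : ContinuousOn (F' r₀) K :=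
    hF'.comp (f := fun x => (r₀, x)) (by fun_prop) fun x hx => ⟨hr₀, hx⟩
  have : IsFiniteMeasure (μ.restrict K) := ⟨by simpa using hK.measure_lt_top⟩
  refine (hasDerivAt_integral_of_dominated_loc_of_deriv_le (bound := fun _ => C)
    (Metric.closedBall_mem_nhds r₀ hε) ?_ ((hF r₀ hr₀).integrableOn_compact hK)
    (hF'₀.aestronglyMeasurable hK.measurableSet) ?_ (integrable_const C) ?_).2
  · filter_upwards [hI.mem_nhds hr₀] with r hr
    exact (hF r hr).aestronglyMeasurable hK.measurableSet
  · filter_upwards [ae_restrict_mem hK.measurableSet] with x hx r hr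
    exact hC (r, x) ⟨hr, hx⟩
  · filter_upwards [ae_restrict_mem hK.measurableSet] with x hx r hr
    exact hderiv r (hball hr) x hx

/-- An iterated interval integral of a continuous function is an integral over a rectangle. -/
theorem intervalIntegral_intervalIntegral_eq_setIntegral_s2 {f : ℝ × ℝ → ℝ} (hf : Continuous f)
    {a b c d : ℝ} (hab : a ≤ b) (hcd : c ≤ d) :
    ∫ t in a..b, ∫ s in c..d, f (t, s) = ∫ z in Icc a b ×ˢ Icc c d, f z := by
  rw [Measure.volume_eq_prod, setIntegral_prod]
  · simp_rw [intervalIntegral.integral_of_le hab, intervalIntegral.integral_of_le hcd,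
      integral_Icc_eq_integral_Ioc]
  · exact hf.continuousOn.integrableOn_compact (isCompact_Icc.prod isCompact_Icc)

/-- **The weighted integral formula `∫ V e^u = −6aϱ² − 12bϱ` (torus case).**
If `u` is a smooth doubly periodic solution of the `SU(∞)` Toda equation on `I × ℝ²`
(`I ⊆ ℝ` an open interval, periods `(1, 0)` and `(α, β)`, `β ≠ 0`) and
`∫₀¹∫₀¹ e^{u(ϱ, s+tα, tβ)} |β| ds dt = aϱ + b` on `I`, then for every `ϱ ∈ I`,
`∫₀¹∫₀¹ (−12ϱ + 6ϱ² ∂u/∂ϱ) e^{u} |β| ds dt = −6aϱ² − 12bϱ`. -/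
theorem toda_torus_weighted_integral
    (I : Set ℝ) (hIopen : IsOpen I) (hIconn : I.OrdConnected)
    (α β : ℝ) (hβ : β ≠ 0) (u : ℝ → ℝ → ℝ → ℝ)
    (hsmooth : ContDiffOn ℝ (⊤ : ℕ∞) (fun p : ℝ × ℝ × ℝ => u p.1 p.2.1 p.2.2)
      (I ×ˢ (univ : Set (ℝ × ℝ))))
    (htoda : ∀ ϱ ∈ I, ∀ x y : ℝ,
      deriv (fun r => deriv (fun r' => Real.exp (u r' x y)) r) ϱ
        + deriv (fun s => deriv (fun s' => u ϱ s' y) s) x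
        + deriv (fun t => deriv (fun t' => u ϱ x t') t) y = 0)
    (hper : ∀ ϱ ∈ I, ∀ x y : ℝ,
      u ϱ (x + 1) y = u ϱ x y ∧ u ϱ (x + α) (y + β) = u ϱ x y)
    (a b : ℝ)
    (hab : ∀ ϱ ∈ I,
      (∫ t in (0:ℝ)..1, ∫ s in (0:ℝ)..1, Real.exp (u ϱ (s + t * α) (t * β)) * |β|)
        = a * ϱ + b) :
    ∀ ϱ ∈ I,
      (∫ t in (0:ℝ)..1, ∫ s in (0:ℝ)..1,
          (-12 * ϱ + 6 * ϱ ^ 2 * deriv (fun r => u r (s + t * α) (t * β)) ϱ)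
            * Real.exp (u ϱ (s + t * α) (t * β)) * |β|)
        = -6 * a * ϱ ^ 2 - 12 * b * ϱ := by
  intro ϱ hϱ
  set L : ℝ × ℝ × ℝ → ℝ × ℝ × ℝ := fun p => (p.1, p.2.2 + p.2.1 * α, p.2.1 * β) with hL
  have hLc : Continuous L := by fun_prop
  have hLmaps : MapsTo L (I ×ˢ univ) (I ×ˢ univ) := fun p hp => ⟨hp.1, mem_univ _⟩
  set U : ℝ × ℝ × ℝ → ℝ := fun p => u p.1 p.2.1 p.2.2 with hU
  have hopen : IsOpen (I ×ˢ (univ : Set (ℝ × ℝ))) := hIopen.prod isOpen_univ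
  have hu : ∀ r ∈ I, ∀ x y, HasDerivAt (fun r => u r x y) (fderiv ℝ U (r, x, y) (1, 0, 0)) r := by
    intro r hr x y
    have hd : HasFDerivAt U (fderiv ℝ U (r, x, y)) (r, x, y) :=
      ((hsmooth.contDiffAt (hopen.mem_nhds ⟨hr, mem_univ _⟩)).differentiableAt
        (by simp)).hasFDerivAt
    exact hd.comp_hasDerivAt r
      ((hasDerivAt_id r).prodMk ((hasDerivAt_const r x).prodMk (hasDerivAt_const r y)))
  have hE : ContinuousOn (fun p => exp (U (L p)) * |β|) (I ×ˢ univ) :=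
    ((hsmooth.continuousOn.comp hLc.continuousOn hLmaps).rexp).mul continuousOn_const
  have hD : ContinuousOn (fun p => fderiv ℝ U (L p) (1, 0, 0)) (I ×ˢ univ) :=
    ((hsmooth.continuousOn_fderiv_of_isOpen hopen (by simp)).comp hLc.continuousOn
      hLmaps).clm_apply continuousOn_const
  have hslice : ∀ {g : ℝ × ℝ × ℝ → ℝ}, ContinuousOn g (I ×ˢ univ) →
      ∀ r ∈ I, Continuous fun z => g (r, z) := fun hg r hr =>
    hg.comp_continuous (by fun_prop) fun z => ⟨hr, mem_univ _⟩
  set K : Set (ℝ × ℝ) := Icc 0 1 ×ˢ Icc 0 1 with hK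
  have hKc : IsCompact K := isCompact_Icc.prod isCompact_Icc
  have hmass : ∀ r ∈ I, ∫ z in K, exp (U (L (r, z))) * |β| = a * r + b := fun r hr =>
    (intervalIntegral_intervalIntegral_eq_setIntegral_s2 (hslice hE r hr) zero_le_one
      zero_le_one).symm.trans (hab r hr)
  have hDE : ContinuousOn
      (fun p => fderiv ℝ U (L p) (1, 0, 0) * (exp (U (L p)) * |β|)) (I ×ˢ univ) := hD.mul hE
  have hderiv := hasDerivAt_setIntegral_of_isCompact (μ := volume) hKc hIopen
    (F := fun r z => exp (U (L (r, z))) * |β|)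
    (F' := fun r z => fderiv ℝ U (L (r, z)) (1, 0, 0) * (exp (U (L (r, z))) * |β|))
    (fun r hr => (hslice hE r hr).continuousOn) (hDE.mono (prod_mono_right (subset_univ K)))
    (fun r hr z _ =>
      ((hu r hr (z.2 + z.1 * α) (z.1 * β)).exp.mul_const |β|).congr_deriv <| by
        simp only [hU, hL]
        ring) hϱ
  have hlin : HasDerivAt (fun r => ∫ z in K, exp (U (L (r, z))) * |β|) a ϱ := by
    have h : HasDerivAt (fun r => a * r + b) a ϱ := by
      simpa using ((hasDerivAt_id ϱ).const_mul a).add_const b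
    exact h.congr_of_eventuallyEq (Filter.eventuallyEq_of_mem (hIopen.mem_nhds hϱ) hmass)
  have hint := hderiv.unique hlin
  calc _ = ∫ t in (0:ℝ)..1, ∫ s in (0:ℝ)..1,
        (-12 * ϱ * (exp (U (L (ϱ, t, s))) * |β|) + 6 * ϱ ^ 2 *
          (fderiv ℝ U (L (ϱ, t, s)) (1, 0, 0) * (exp (U (L (ϱ, t, s))) * |β|))) := by
        simp_rw [fun x y => (hu ϱ hϱ x y).deriv]
        congr! 4
        simp only [hU, hL]
        ring
    _ = ∫ z in K, (-12 * ϱ * (exp (U (L (ϱ, z))) * |β|) + 6 * ϱ ^ 2 *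
          (fderiv ℝ U (L (ϱ, z)) (1, 0, 0) * (exp (U (L (ϱ, z))) * |β|))) :=
        intervalIntegral_intervalIntegral_eq_setIntegral_s2
          (((hslice hE ϱ hϱ).const_mul _).add ((hslice hDE ϱ hϱ).const_mul _))
          zero_le_one zero_le_one
    _ = -12 * ϱ * (a * ϱ + b) + 6 * ϱ ^ 2 * a := by
        rw [integral_add
          (((hslice hE ϱ hϱ).continuousOn.integrableOn_compact hKc).const_mul _)
          (((hslice hDE ϱ hϱ).continuousOn.integrableOn_compact hKc).const_mul _),
          integral_const_mul, integral_const_mul, hmass ϱ hϱ, hint]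
    _ = _ := by ring
end

section
/- Let k be a nonnegative integer, R ≥ 1, and C > 0. Suppose w : (R, ∞) → ℝ is twice continuously differentiable, q : (R, ∞) → ℝ is continuous with |q(ϱ)| ≤ C ϱ^{−2} for all ϱ ∈ (R, ∞), the differential equation (d²/dϱ²)(ϱ² w(ϱ)) − k(k+1) w(ϱ) = q(ϱ) holds on (R, ∞), and ϱ·w(ϱ) → 0 as ϱ → ∞. Then for every δ ∈ (0, 1) there exists C′ > 0 such that |w(ϱ)| ≤ C′ ϱ^{−1−δ} for all ϱ ≥ R + 1. -/
open Set Real Filter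

theorem le_of_hasDerivAt_nonneg_Ioi {R : ℝ} {f f' : ℝ → ℝ}
    (hf : ∀ x, R < x → HasDerivAt f (f' x) x) (hf' : ∀ x, R < x → 0 ≤ f' x)
    {x y : ℝ} (hx : R < x) (hxy : x ≤ y) : f x ≤ f y := by
  have hmono : MonotoneOn f (Ioi R) := by
    refine monotoneOn_of_deriv_nonneg (convex_Ioi R)
      (fun z hz => (hf z hz).continuousAt.continuousWithinAt) ?_ ?_
    · rw [interior_Ioi]
      exact fun z hz => (hf z hz).differentiableAt.differentiableWithinAt
    · rw [interior_Ioi]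
      intro z hz
      rw [(hf z hz).deriv]
      exact hf' z hz
  exact hmono hx (lt_of_lt_of_le hx hxy) hxy

theorem hasDerivAt_rpow_div {x : ℝ} (hx : 0 < x) (s : ℝ) :
    HasDerivAt (fun y : ℝ => y ^ s) (s * (x ^ s / x)) x := by
  rw [← rpow_sub_one hx.ne']
  exact Real.hasDerivAt_rpow_const (Or.inl hx.ne')

/-- A solution of `d²v/dx² = κ (κ + 1) v / x² + q` with `q ≥ -C / x²` and `v = o(x)` satisfies the
first-order inequality `dv/dx + κ v / x ≤ C / ((κ + 1) x)`. -/
theorem first_order_bound_of_sublinear {κ R C : ℝ} (hκ : 0 ≤ κ) (hR : 1 ≤ R) (hC : 0 < C)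
    {v v₁ q : ℝ → ℝ} (hv : ∀ x, R < x → HasDerivAt v (v₁ x) x)
    (hv₁ : ∀ x, R < x → HasDerivAt v₁ (κ * (κ + 1) * (v x / x ^ 2) + q x) x)
    (hq : ∀ x, R < x → -(C / x ^ 2) ≤ q x)
    (hlim : Tendsto (fun x => v x / x) atTop (nhds 0)) {x : ℝ} (hx : R < x) :
    v₁ x + κ * (v x / x) ≤ C / (κ + 1) / x := by
  have hκ1 : 0 < κ + 1 := by linarith
  have hF : ∀ y, R < y → HasDerivAt
      (fun y => (v₁ y + κ * (v y / y)) * y ^ (-κ) - C / (κ + 1) * y ^ (-κ - 1))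
      (y ^ (-κ) * (q y + C / y ^ 2)) y := by
    intro y hy
    have hy0 : 0 < y := by linarith
    have h := (((hv₁ y hy).add (((hv y hy).div (hasDerivAt_id y) hy0.ne').const_mul κ)).mul
      (hasDerivAt_rpow_div hy0 (-κ))).sub
      ((hasDerivAt_rpow_div hy0 (-κ - 1)).const_mul (C / (κ + 1)))
    refine h.congr_deriv ?_
    rw [rpow_sub_one hy0.ne']
    simp only [id, Pi.add_apply, Pi.div_apply]
    field_simp
    ring
  have hFmono : ∀ {a b : ℝ}, R < a → a ≤ b → _ ≤ _ := fun {a b} ha hab =>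
    le_of_hasDerivAt_nonneg_Ioi hF (fun y hy => by
      have hy0 : 0 < y := by linarith
      exact mul_nonneg (rpow_nonneg hy0.le _) (by linarith [hq y hy])) ha hab
  have hx0 : 0 < x := by linarith
  by_contra! hcon
  set L : ℝ := (v₁ x + κ * (v x / x)) * x ^ (-κ) - C / (κ + 1) * x ^ (-κ - 1) with hL
  have hLpos : 0 < L := by
    have hp : 0 < x ^ (-κ) := rpow_pos_of_pos hx0 _
    have : L = x ^ (-κ) * (v₁ x + κ * (v x / x) - C / (κ + 1) / x) := by
      rw [hL, rpow_sub_one hx0.ne']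
      ring
    rw [this]
    exact mul_pos hp (by linarith)
  have hz : ∀ y, x ≤ y → L * y ^ κ ≤ v₁ y + κ * (v y / y) := by
    intro y hy
    have hy0 : 0 < y := by linarith
    have h1 := hFmono hx hy
    have h2 : 0 ≤ C / (κ + 1) * y ^ (-κ - 1) := by positivity
    have hp : 0 < y ^ κ := rpow_pos_of_pos hy0 _
    have h3 : L ≤ (v₁ y + κ * (v y / y)) / y ^ κ := by
      rw [div_eq_mul_inv, ← rpow_neg hy0.le]
      linarith
    exact (le_div_iff₀ hp).1 h3
  have hG : ∀ y, x < y → HasDerivAt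
      (fun y => v y * y ^ κ - L / (2 * κ + 1) * y ^ (2 * κ + 1))
      (y ^ κ * (v₁ y + κ * (v y / y) - L * y ^ κ)) y := by
    intro y hy
    have hy0 : 0 < y := by linarith
    have h := ((hv y (hx.trans hy)).mul (hasDerivAt_rpow_div hy0 κ)).sub
      ((hasDerivAt_rpow_div hy0 (2 * κ + 1)).const_mul (L / (2 * κ + 1)))
    refine h.congr_deriv ?_
    have : y ^ (2 * κ + 1) = y ^ κ * y ^ κ * y := by
      rw [rpow_add_one hy0.ne', two_mul, rpow_add hy0]
    rw [this]
    field_simp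
  set a : ℝ := x + 1
  set c : ℝ := v a * a ^ κ - L / (2 * κ + 1) * a ^ (2 * κ + 1)
  have hlow : ∀ y, a ≤ y → L / (2 * κ + 1) - |c| / y ≤ v y / y := by
    intro y hy
    have hy1 : 1 ≤ y := by linarith
    have hy0 : 0 < y := by linarith
    have h1 : c ≤ v y * y ^ κ - L / (2 * κ + 1) * y ^ (2 * κ + 1) :=
      le_of_hasDerivAt_nonneg_Ioi hG (fun t ht => mul_nonneg
        (rpow_nonneg (by linarith) _) (by linarith [hz t ht.le])) (by linarith) hy
    have hp : 1 ≤ y ^ κ := one_le_rpow hy1 hκ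
    have h2 : y ^ (2 * κ + 1) = y ^ κ * y ^ κ * y := by
      rw [rpow_add_one hy0.ne', two_mul, rpow_add hy0]
    rw [h2] at h1
    have hM : 0 ≤ L / (2 * κ + 1) := by positivity
    set M := L / (2 * κ + 1)
    rw [le_div_iff₀ hy0, sub_mul, div_mul_cancel₀ _ hy0.ne']
    refine le_of_mul_le_mul_right ?_ (lt_of_lt_of_le one_pos hp)
    have h3 : M * y * y ^ κ ≤ M * (y ^ κ * y ^ κ * y) := by
      nlinarith [mul_nonneg (mul_nonneg (mul_nonneg hM hy0.le) (by linarith : 0 ≤ y ^ κ))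
        (by linarith : 0 ≤ y ^ κ - 1)]
    nlinarith [neg_abs_le c, mul_nonneg (abs_nonneg c) (by linarith : 0 ≤ y ^ κ - 1)]
  have hlim' : Tendsto (fun y : ℝ => L / (2 * κ + 1) - |c| / y) atTop
      (nhds (L / (2 * κ + 1) - 0)) :=
    tendsto_const_nhds.sub (tendsto_const_nhds.div_atTop tendsto_id)
  have hle := le_of_tendsto_of_tendsto hlim' hlim
    (by filter_upwards [eventually_ge_atTop a] with y hy using hlow y hy)
  have : 0 < L / (2 * κ + 1) := by positivity
  linarith

/-- A solution of `d²v/dx² = κ (κ + 1) v / x² + q` with `q ≥ -C / x²` and `v = o(x)` is bounded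
above by a multiple of `x ^ (1 - δ)` for every `δ < 1`. -/
theorem exists_le_rpow_of_sublinear {κ R C δ : ℝ} (hκ : 0 ≤ κ) (hR : 1 ≤ R) (hC : 0 < C)
    (hδ : δ < 1)
    {v v₁ q : ℝ → ℝ} (hv : ∀ x, R < x → HasDerivAt v (v₁ x) x)
    (hv₁ : ∀ x, R < x → HasDerivAt v₁ (κ * (κ + 1) * (v x / x ^ 2) + q x) x)
    (hq : ∀ x, R < x → -(C / x ^ 2) ≤ q x)
    (hlim : Tendsto (fun x => v x / x) atTop (nhds 0)) :
    ∃ C' > 0, ∀ x ≥ R + 1, v x ≤ C' * x ^ (1 - δ) := by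
  have hs : 0 < κ + 1 - δ := by linarith
  have hG : ∀ y, R < y → HasDerivAt
      (fun y => C / (κ + 1 - δ) * y ^ (κ + 1 - δ) - v y * y ^ κ)
      (y ^ κ * (C * (y ^ (1 - δ) / y) - (v₁ y + κ * (v y / y)))) y := by
    intro y hy
    have hy0 : 0 < y := by linarith
    have h := ((hasDerivAt_rpow_div hy0 (κ + 1 - δ)).const_mul (C / (κ + 1 - δ))).sub
      ((hv y hy).mul (hasDerivAt_rpow_div hy0 κ))
    refine h.congr_deriv ?_
    rw [show κ + 1 - δ = κ + (1 - δ) by ring, rpow_add hy0]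
    rw [show κ + 1 - δ = κ + (1 - δ) by ring] at hs
    field_simp
  have hG' : ∀ y, R < y → 0 ≤ y ^ κ * (C * (y ^ (1 - δ) / y) - (v₁ y + κ * (v y / y))) := by
    intro y hy
    have hy0 : 0 < y := by linarith
    refine mul_nonneg (rpow_nonneg hy0.le _) (sub_nonneg.2 ?_)
    refine (first_order_bound_of_sublinear hκ hR hC hv hv₁ hq hlim hy).trans ?_
    rw [← mul_div_assoc]
    gcongr
    have h1 : C / (κ + 1) ≤ C := div_le_self hC.le (by linarith)
    have h2 : 1 ≤ y ^ (1 - δ) := one_le_rpow (by linarith) (by linarith)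
    nlinarith
  set c : ℝ := C / (κ + 1 - δ) * (R + 1) ^ (κ + 1 - δ) - v (R + 1) * (R + 1) ^ κ
  refine ⟨C / (κ + 1 - δ) + |c|, by positivity, fun x hx => ?_⟩
  have hx1 : 1 ≤ x := by linarith
  have hx0 : 0 < x := by linarith
  have h1 : c ≤ C / (κ + 1 - δ) * x ^ (κ + 1 - δ) - v x * x ^ κ :=
    le_of_hasDerivAt_nonneg_Ioi hG hG' (by linarith) hx
  have hp : 1 ≤ x ^ κ := one_le_rpow hx1 hκ
  have hp' : 1 ≤ x ^ (1 - δ) := one_le_rpow hx1 (by linarith)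
  rw [show x ^ (κ + 1 - δ) = x ^ κ * x ^ (1 - δ) by rw [← rpow_add hx0]; ring_nf] at h1
  refine le_of_mul_le_mul_right ?_ (lt_of_lt_of_le one_pos hp)
  have h2 : |c| ≤ |c| * (x ^ (1 - δ) * x ^ κ) :=
    le_mul_of_one_le_right (abs_nonneg c) (one_le_mul_of_one_le_of_one_le hp' hp)
  nlinarith [neg_abs_le c]

/-- **Decay for the inhomogeneous radial ODE.**
Suppose `w : (R, ∞) → ℝ` is `C²`, `q` is continuous with `|q(ϱ)| ≤ C ϱ⁻²`,
`(d²/dϱ²)(ϱ² w) − k(k+1) w = q` on `(R, ∞)`, and `ϱ · w(ϱ) → 0` as `ϱ → ∞`.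
Then for every `δ ∈ (0, 1)` there is `C′ > 0` with `|w(ϱ)| ≤ C′ ϱ^{−1−δ}` for `ϱ ≥ R + 1`. -/
theorem ode_inhomogeneous_decay (k : ℕ) (R C : ℝ) (hR : 1 ≤ R) (hC : 0 < C)
    (w q : ℝ → ℝ)
    (hw : ContDiffOn ℝ 2 w (Ioi R))
    (hq : ContinuousOn q (Ioi R))
    (hqbound : ∀ ϱ ∈ Ioi R, |q ϱ| ≤ C * ϱ ^ (-2 : ℝ))
    (hode : ∀ ϱ ∈ Ioi R,
      deriv (deriv (fun r : ℝ => r ^ 2 * w r)) ϱ - (k * (k + 1) : ℝ) * w ϱ = q ϱ)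
    (hdecay : Tendsto (fun ϱ : ℝ => ϱ * w ϱ) atTop (nhds 0)) :
    ∀ δ ∈ Ioo (0:ℝ) 1, ∃ C' > 0, ∀ ϱ ≥ R + 1, |w ϱ| ≤ C' * ϱ ^ (-1 - δ) := by
  rintro δ ⟨-, hδ⟩
  set v : ℝ → ℝ := fun r => r ^ 2 * w r with hv
  have hvC : ContDiffOn ℝ 2 v (Ioi R) := (contDiff_id.pow 2).contDiffOn.mul hw
  have hd : ∀ x, R < x → HasDerivAt v (deriv v x) x := fun x hx =>
    ((hvC.differentiableOn (by norm_num)).differentiableAt (Ioi_mem_nhds hx)).hasDerivAt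
  have hdv : ContDiffOn ℝ 1 (deriv v) (Ioi R) :=
    hvC.deriv_of_isOpen isOpen_Ioi (by norm_num)
  have hdd : ∀ x, R < x →
      HasDerivAt (deriv v) ((k : ℝ) * (k + 1) * (v x / x ^ 2) + q x) x := by
    intro x hx
    have hx0 : x ≠ 0 := by linarith
    refine ((hdv.differentiableOn (by norm_num)).differentiableAt
      (Ioi_mem_nhds hx)).hasDerivAt.congr_deriv ?_
    have hvx : v x / x ^ 2 = w x := by
      simp only [hv]
      field_simp
    rw [hvx, ← hode x hx]
    ring
  have hqb : ∀ x, R < x → |q x| ≤ C / x ^ 2 := by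
    intro x hx
    have h := hqbound x hx
    rwa [rpow_neg (by linarith), rpow_two, ← div_eq_mul_inv] at h
  have hlim : Tendsto (fun x => v x / x) atTop (nhds 0) := by
    refine hdecay.congr' ?_
    filter_upwards [eventually_gt_atTop 0] with x hx
    simp only [hv]
    field_simp
  obtain ⟨A, hA, hAv⟩ := exists_le_rpow_of_sublinear (Nat.cast_nonneg k) hR hC hδ hd hdd
    (fun x hx => (abs_le.1 (hqb x hx)).1) hlim
  obtain ⟨B, hB, hBv⟩ := exists_le_rpow_of_sublinear (v := fun x => -v x)
    (v₁ := fun x => -deriv v x) (q := fun x => -q x) (Nat.cast_nonneg k) hR hC hδ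
    (fun x hx => (hd x hx).neg)
    (fun x hx => (hdd x hx).neg.congr_deriv (by ring))
    (fun x hx => neg_le_neg (abs_le.1 (hqb x hx)).2)
    (by simpa [neg_div] using hlim.neg)
  refine ⟨A + B, by positivity, fun x hx => ?_⟩
  have hx0 : 0 < x := by linarith
  have hp : 0 < x ^ (1 - δ) := rpow_pos_of_pos hx0 _
  have hvle : |v x| ≤ (A + B) * x ^ (1 - δ) := by
    rw [abs_le]
    constructor <;> nlinarith [hAv x hx, hBv x hx, mul_pos hA hp, mul_pos hB hp]
  have hpow : x ^ (1 - δ) = x ^ 2 * x ^ (-1 - δ) := by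
    rw [← rpow_two, ← rpow_add hx0]
    ring_nf
  rw [hpow, hv, abs_mul, abs_of_pos (pow_pos hx0 2)] at hvle
  refine le_of_mul_le_mul_left ?_ (pow_pos hx0 2)
  linarith
end

section
/- Let u : (0, ∞) × ℝ² → ℝ be smooth. Then the following are equivalent: (a) u satisfies the SU(∞) Toda equation ∂²(e^u)/∂ϱ² + ∂²u/∂x² + ∂²u/∂y² = 0 and −12ϱ + 6ϱ² ∂u/∂ϱ = 0 at every point of (0, ∞) × ℝ²; (b) there exists a smooth function ϖ : ℝ² → ℝ satisfying the Liouville equation ∂²ϖ/∂x² + ∂²ϖ/∂y² = −2 e^{ϖ} such that u(ϱ, x, y) = 2 log ϱ + ϖ(x, y) for all (ϱ, x, y) ∈ (0, ∞) × ℝ². -/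
open Set Real

/-- A function on the half-line with derivative `2 / r` is `2 log r` up to a constant. -/
theorem eq_two_mul_log_add_of_deriv_eq {g : ℝ → ℝ} (hg : DifferentiableOn ℝ g (Ioi 0))
    (hg' : ∀ r ∈ Ioi (0:ℝ), deriv g r = 2 / r) {r : ℝ} (hr : r ∈ Ioi (0:ℝ)) :
    g r = 2 * Real.log r + g 1 := by
  have hlog : ∀ r ∈ Ioi (0:ℝ),
      HasDerivAt (fun s => 2 * Real.log s + g 1) (2 / r) r := fun r hr => by
    simpa [div_eq_mul_inv] using
      ((Real.hasDerivAt_log (ne_of_gt hr)).const_mul 2).add_const (g 1)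
  refine isOpen_Ioi.eqOn_of_deriv_eq isPreconnected_Ioi hg
    (fun s hs => (hlog s hs).differentiableAt.differentiableWithinAt)
    (fun s hs => (hg' s hs).trans (hlog s hs).deriv.symm)
    (mem_Ioi.2 one_pos) (by simp) hr

/-- The second derivative of `exp (2 log r + c) = r ^ 2 * exp c` on the half-line. -/
theorem deriv_deriv_exp_of_eq_two_mul_log_add {g : ℝ → ℝ} {c : ℝ}
    (hg : ∀ r ∈ Ioi (0:ℝ), g r = 2 * Real.log r + c) {r : ℝ} (hr : r ∈ Ioi (0:ℝ)) :
    deriv (fun s => deriv (fun s' => Real.exp (g s')) s) r = 2 * Real.exp c := by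
  have hexp : EqOn (fun s => Real.exp (g s)) (fun s => s ^ 2 * Real.exp c) (Ioi 0) := by
    intro s hs
    have h : Real.exp (2 * Real.log s) = s ^ 2 := by
      rw [two_mul, Real.exp_add, Real.exp_log hs, sq]
    simp only [hg s hs, Real.exp_add, h]
  have hderiv : EqOn (deriv fun s => Real.exp (g s)) (fun s => 2 * s * Real.exp c) (Ioi 0) := by
    intro s hs
    rw [hexp.deriv isOpen_Ioi hs]
    simp
  change deriv (deriv fun s => Real.exp (g s)) r = _
  rw [hderiv.deriv isOpen_Ioi hr]
  simp

/-- For `u = 2 log ϱ + ϖ`, the left side of the Toda equation is `Δϖ + 2 exp ϖ`. -/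
theorem toda_eq_liouville_of_eq_two_mul_log_add {u : ℝ → ℝ → ℝ → ℝ} {ϖ : ℝ → ℝ → ℝ}
    (hu : ∀ ϱ ∈ Ioi (0:ℝ), ∀ x y : ℝ, u ϱ x y = 2 * Real.log ϱ + ϖ x y)
    {ϱ : ℝ} (hϱ : ϱ ∈ Ioi (0:ℝ)) (x y : ℝ) :
    deriv (fun r => deriv (fun r' => Real.exp (u r' x y)) r) ϱ
        + deriv (fun s => deriv (fun s' => u ϱ s' y) s) x
        + deriv (fun t => deriv (fun t' => u ϱ x t') t) y
      = 2 * Real.exp (ϖ x y) + deriv (fun s => deriv (fun s' => ϖ s' y) s) x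
        + deriv (fun t => deriv (fun t' => ϖ x t') t) y := by
  rw [deriv_deriv_exp_of_eq_two_mul_log_add (fun r hr => hu r hr x y) hϱ]
  simp only [hu ϱ hϱ, deriv_const_add]

/-- **Characterization of Toda solutions with vanishing `V` on `(0, ∞) × ℝ²`.**
A smooth `u` satisfies the `SU(∞)` Toda equation together with
`−12ϱ + 6ϱ² ∂u/∂ϱ = 0` if and only if `u(ϱ, x, y) = 2 log ϱ + ϖ(x, y)` for a smooth
solution `ϖ` of the Liouville equation `ϖ_{xx} + ϖ_{yy} = −2 e^{ϖ}`. -/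
theorem toda_vanishing_V_characterization (u : ℝ → ℝ → ℝ → ℝ)
    (hsmooth : ContDiffOn ℝ (⊤ : ℕ∞) (fun p : ℝ × ℝ × ℝ => u p.1 p.2.1 p.2.2)
      (Ioi (0:ℝ) ×ˢ (univ : Set (ℝ × ℝ)))) :
    (∀ ϱ ∈ Ioi (0:ℝ), ∀ x y : ℝ,
        deriv (fun r => deriv (fun r' => Real.exp (u r' x y)) r) ϱ
            + deriv (fun s => deriv (fun s' => u ϱ s' y) s) x
            + deriv (fun t => deriv (fun t' => u ϱ x t') t) y = 0 ∧
        -12 * ϱ + 6 * ϱ ^ 2 * deriv (fun r => u r x y) ϱ = 0)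
      ↔ ∃ ϖ : ℝ → ℝ → ℝ,
          ContDiff ℝ (⊤ : ℕ∞) (fun p : ℝ × ℝ => ϖ p.1 p.2) ∧
          (∀ x y : ℝ,
            deriv (fun s => deriv (fun s' => ϖ s' y) s) x
              + deriv (fun t => deriv (fun t' => ϖ x t') t) y
              = -2 * Real.exp (ϖ x y)) ∧
          (∀ ϱ ∈ Ioi (0:ℝ), ∀ x y : ℝ,
            u ϱ x y = 2 * Real.log ϱ + ϖ x y) := by
  constructor
  · intro h
    have hu : ∀ ϱ ∈ Ioi (0:ℝ), ∀ x y : ℝ, u ϱ x y = 2 * Real.log ϱ + u 1 x y := by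
      intro ϱ hϱ x y
      refine eq_two_mul_log_add_of_deriv_eq (g := fun r => u r x y) ?_ (fun r hr => ?_) hϱ
      · exact (hsmooth.differentiableOn (by simp)).comp (f := fun r : ℝ => (r, x, y))
          (by fun_prop) fun r hr => ⟨hr, mem_univ _⟩
      · have hr0 : r ≠ 0 := ne_of_gt hr
        rw [eq_div_iff hr0]
        apply mul_left_cancel₀ hr0
        linear_combination (h r hr x y).2 / 6
    refine ⟨u 1, ?_, fun x y => ?_, hu⟩
    · exact hsmooth.comp_contDiff (f := fun p : ℝ × ℝ => ((1 : ℝ), p)) (by fun_prop)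
        fun p => ⟨mem_Ioi.2 one_pos, mem_univ _⟩
    · have h1 : (1 : ℝ) ∈ Ioi (0:ℝ) := mem_Ioi.2 one_pos
      linear_combination (h 1 h1 x y).1 - toda_eq_liouville_of_eq_two_mul_log_add hu h1 x y
  · rintro ⟨ϖ, -, hL, hu⟩ ϱ hϱ x y
    refine ⟨?_, ?_⟩
    · linear_combination toda_eq_liouville_of_eq_two_mul_log_add hu hϱ x y + hL x y
    · have hϱ0 : ϱ ≠ 0 := ne_of_gt hϱ
      have heq : EqOn (fun r => u r x y) (fun r => 2 * Real.log r + ϖ x y) (Ioi 0) :=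
        fun r hr => hu r hr x y
      rw [heq.deriv isOpen_Ioi hϱ, deriv_add_const, deriv_const_mul_field, Real.deriv_log]
      field_simp
      ring
end

section
/- Let α, β ∈ ℝ with β ≠ 0, let R ≥ 1, C > 0, a > 0 and b ∈ ℝ. Let u : (R, ∞) × ℝ² → ℝ be continuous and doubly periodic in (x, y) with periods (1, 0) and (α, β). For ϱ ∈ (R, ∞) set ū(ϱ) = ∫₀¹∫₀¹ u(ϱ, s+tα, tβ) ds dt. Assume that for every ϱ ∈ (R, ∞): sup_{(x,y)∈ℝ²} |u(ϱ, x, y) − ū(ϱ)| ≤ C/ϱ, and ∫₀¹∫₀¹ e^{u(ϱ, s+tα, tβ)} |β| ds dt = aϱ + b. Then there exist C′ > 0 and R′ ≥ R such that for all ϱ > R′, sup_{(x,y)∈ℝ²} |u(ϱ, x, y) − log ϱ − log(a/|β|)| ≤ C′/ϱ. -/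
open Set Real

open intervalIntegral in
/-- Bounds on a continuous function pass to its average over the unit square. -/
theorem integral_unitSquare_mem_Icc {f : ℝ → ℝ → ℝ} (hf : Continuous (Function.uncurry f))
    {c d : ℝ} (h : ∀ t s, f t s ∈ Icc c d) :
    (∫ t in (0:ℝ)..1, ∫ s in (0:ℝ)..1, f t s) ∈ Icc c d := by
  have unit_Icc : ∀ {g : ℝ → ℝ}, Continuous g → (∀ t, g t ∈ Icc c d) →
      (∫ t in (0:ℝ)..1, g t) ∈ Icc c d := by
    intro g hg hb
    constructor
    · simpa using integral_mono (μ := MeasureTheory.volume) (a := 0) (b := 1) zero_le_one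
        (continuous_const.intervalIntegrable 0 1) (hg.intervalIntegrable 0 1) fun t => (hb t).1
    · simpa using integral_mono (μ := MeasureTheory.volume) (a := 0) (b := 1) zero_le_one
        (hg.intervalIntegrable 0 1) (continuous_const.intervalIntegrable 0 1) fun t => (hb t).2
  exact unit_Icc (continuous_parametric_intervalIntegral_of_continuous' hf 0 1)
    fun t => unit_Icc (hf.uncurry_left t) (h t)

theorem abs_log_one_add_le {z : ℝ} (hz : |z| ≤ 1 / 2) : |log (1 + z)| ≤ 2 * |z| := by
  have hz' := abs_le.mp hz
  have hpos : 0 < 1 + z := by linarith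
  have hupper := log_le_sub_one_of_pos hpos
  have hlower := one_sub_inv_le_log_of_pos hpos
  have hinv : (1 + z)⁻¹ - 1 ≤ 2 * |z| := by
    rw [sub_le_iff_le_add, inv_le_iff_one_le_mul₀ hpos]
    nlinarith [neg_abs_le z, abs_nonneg z]
  rw [abs_le]
  constructor <;> linarith [le_abs_self z, abs_nonneg z]

/-- **From small oscillation and the affine integral formula to `u = log ϱ + a′ + O(1/ϱ)`.**
Let `u` be continuous on `(R, ∞) × ℝ²`, doubly periodic in `(x, y)` with periods `(1, 0)`
and `(α, β)` (`β ≠ 0`). If the oscillation of `u` about its torus average `ū` is `≤ C/ϱ`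
and `∫₀¹∫₀¹ e^{u(ϱ, s+tα, tβ)} |β| ds dt = aϱ + b` with `a > 0`, then uniformly
`|u − log ϱ − log(a/|β|)| ≤ C′/ϱ` for all sufficiently large `ϱ`. -/
theorem toda_average_asymptotics
    (α β : ℝ) (hβ : β ≠ 0) (R C a b : ℝ) (hR : 1 ≤ R) (hC : 0 < C) (ha : 0 < a)
    (u : ℝ → ℝ → ℝ → ℝ)
    (hcont : ContinuousOn (fun p : ℝ × ℝ × ℝ => u p.1 p.2.1 p.2.2)
      (Ioi R ×ˢ (univ : Set (ℝ × ℝ))))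
    (hper : ∀ ϱ ∈ Ioi R, ∀ x y : ℝ,
      u ϱ (x + 1) y = u ϱ x y ∧ u ϱ (x + α) (y + β) = u ϱ x y)
    (hosc : ∀ ϱ ∈ Ioi R, ∀ x y : ℝ,
      |u ϱ x y - (∫ t in (0:ℝ)..1, ∫ s in (0:ℝ)..1, u ϱ (s + t * α) (t * β))| ≤ C / ϱ)
    (hint : ∀ ϱ ∈ Ioi R,
      (∫ t in (0:ℝ)..1, ∫ s in (0:ℝ)..1, Real.exp (u ϱ (s + t * α) (t * β)) * |β|)
        = a * ϱ + b) :
    ∃ C' > 0, ∃ R' ≥ R, ∀ ϱ > R', ∀ x y : ℝ,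
      |u ϱ x y - Real.log ϱ - Real.log (a / |β|)| ≤ C' / ϱ := by
  refine ⟨2 * C + 2 * (|b| / a), by positivity, max R (2 * |b| / a), le_max_left _ _, ?_⟩
  intro ϱ hϱ x y
  obtain ⟨hRϱ, hbϱ⟩ := max_lt_iff.mp hϱ
  have hϱ0 : 0 < ϱ := by linarith
  have hB : 0 < |β| := abs_pos.mpr hβ
  have hosc' := hosc ϱ hRϱ
  set m := ∫ t in (0:ℝ)..1, ∫ s in (0:ℝ)..1, u ϱ (s + t * α) (t * β)
  have hslice : Continuous fun p : ℝ × ℝ => u ϱ (p.2 + p.1 * α) (p.1 * β) :=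
    hcont.comp_continuous (f := fun p : ℝ × ℝ => (ϱ, p.2 + p.1 * α, p.1 * β))
      (by fun_prop) fun p => ⟨hRϱ, mem_univ _⟩
  have hmem := integral_unitSquare_mem_Icc
    (f := fun t s => exp (u ϱ (s + t * α) (t * β)) * |β|)
    (c := exp (m - C / ϱ) * |β|) (d := exp (m + C / ϱ) * |β|)
    (hslice.rexp.mul continuous_const) fun t s => by
      have h := abs_le.mp (hosc' (s + t * α) (t * β))
      constructor <;> gcongr <;> linarith
  rw [hint ϱ hRϱ] at hmem
  have hpos : 0 < a * ϱ + b := lt_of_lt_of_le (by positivity) hmem.1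
  have hlower : m - C / ϱ ≤ log ((a * ϱ + b) / |β|) := by
    rw [le_log_iff_exp_le (by positivity), le_div_iff₀ hB]
    exact hmem.1
  have hupper : log ((a * ϱ + b) / |β|) ≤ m + C / ϱ := by
    rw [log_le_iff_le_exp (by positivity), div_le_iff₀ hB]
    exact hmem.2
  have habs : |b / (a * ϱ)| = |b| / a / ϱ := by
    rw [abs_div, abs_of_pos (by positivity : 0 < a * ϱ), div_div]
  have hlog := abs_log_one_add_le (z := b / (a * ϱ)) (by
    rw [habs, div_le_iff₀ hϱ0]
    linarith [mul_div_assoc 2 |b| a])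
  rw [habs] at hlog
  have hsplit : log ((a * ϱ + b) / |β|) = log ϱ + log (a / |β|) + log (1 + b / (a * ϱ)) := by
    have hone : 1 + b / (a * ϱ) = (a * ϱ + b) / (a * ϱ) := by field_simp
    rw [hone, log_div hpos.ne' hB.ne', log_div ha.ne' hB.ne',
      log_div hpos.ne' (by positivity), log_mul ha.ne' hϱ0.ne']
    ring
  have hC' : (2 * C + 2 * (|b| / a)) / ϱ = 2 * (C / ϱ) + 2 * (|b| / a / ϱ) := by ring
  have hu := abs_le.mp (hosc' x y)
  have hl := abs_le.mp hlog
  rw [hC', abs_le]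
  constructor <;> linarith
end

section
/- Let N ≥ 0 and let α, β ∈ ℝ with β ≠ 0. Let u : (−∞, −N) × ℝ² → ℝ be a smooth function satisfying the SU(∞) Toda equation ∂²(e^u)/∂ϱ² + ∂²u/∂x² + ∂²u/∂y² = 0, doubly periodic in (x, y) with periods (1, 0) and (α, β), and such that −12ϱ + 6ϱ² ∂u/∂ϱ > 0 at every point of (−∞, −N) × ℝ². If a, b ∈ ℝ are constants with ∫₀¹∫₀¹ e^{u(ϱ, s+tα, tβ)} |β| ds dt = aϱ + b for all ϱ ∈ (−∞, −N), then either a < 0, or a = 0 and b > 0. -/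
open Set Real

/-- The iterated integral over the unit square of a continuous positive function is positive. -/
theorem intervalIntegral_intervalIntegral_pos {f : ℝ → ℝ → ℝ}
    (hf : Continuous (Function.uncurry f)) (hpos : ∀ t s, 0 < f t s) :
    0 < ∫ t in (0:ℝ)..1, ∫ s in (0:ℝ)..1, f t s := by
  have hinner : Continuous fun t => ∫ s in (0:ℝ)..1, f t s :=
    intervalIntegral.continuous_parametric_intervalIntegral_of_continuous' hf 0 1
  refine intervalIntegral.intervalIntegral_pos_of_pos (hinner.intervalIntegrable 0 1)
    (fun t => ?_) one_pos
  have hslice : Continuous (f t) := hf.comp (Continuous.prodMk_right t)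
  exact intervalIntegral.intervalIntegral_pos_of_pos (hslice.intervalIntegrable 0 1)
    (hpos t) one_pos

/-- An affine function that is positive on a left half-line has nonpositive slope, and is a
positive constant if the slope vanishes. -/
theorem neg_or_eq_zero_and_pos_of_affine_pos {a b c : ℝ}
    (h : ∀ r ∈ Iio c, 0 < a * r + b) : a < 0 ∨ (a = 0 ∧ 0 < b) := by
  rcases lt_trichotomy a 0 with ha | rfl | ha
  · exact Or.inl ha
  · exact Or.inr ⟨rfl, by simpa using h (c - 1) (by simp)⟩
  · exfalso
    have hr := h (min (c - 1) (-b / a)) ((min_le_left _ _).trans_lt (sub_one_lt c))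
    have hle : a * min (c - 1) (-b / a) ≤ a * (-b / a) :=
      mul_le_mul_of_nonneg_left (min_le_right _ _) ha.le
    have hcancel : a * (-b / a) = -b := by field_simp
    linarith

/-- **Dichotomy `a < 0`, or `a = 0` and `b > 0` (Kasner versus ALH* models).**
Let `u` be a smooth doubly periodic solution (periods `(1,0)` and `(α, β)`, `β ≠ 0`)
of the `SU(∞)` Toda equation on `(−∞, −N) × ℝ²` with
`V = −12ϱ + 6ϱ² ∂u/∂ϱ > 0` everywhere. If
`∫₀¹∫₀¹ e^{u(ϱ, s+tα, tβ)} |β| ds dt = aϱ + b` on `(−∞, −N)`, then either `a < 0`,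
or `a = 0` and `b > 0`. -/
theorem toda_negative_end_dichotomy
    (N : ℝ) (hN : 0 ≤ N) (α β : ℝ) (hβ : β ≠ 0) (u : ℝ → ℝ → ℝ → ℝ)
    (hsmooth : ContDiffOn ℝ (⊤ : ℕ∞) (fun p : ℝ × ℝ × ℝ => u p.1 p.2.1 p.2.2)
      (Iio (-N) ×ˢ (univ : Set (ℝ × ℝ))))
    (htoda : ∀ ϱ ∈ Iio (-N), ∀ x y : ℝ,
      deriv (fun r => deriv (fun r' => Real.exp (u r' x y)) r) ϱ
        + deriv (fun s => deriv (fun s' => u ϱ s' y) s) x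
        + deriv (fun t => deriv (fun t' => u ϱ x t') t) y = 0)
    (hper : ∀ ϱ ∈ Iio (-N), ∀ x y : ℝ,
      u ϱ (x + 1) y = u ϱ x y ∧ u ϱ (x + α) (y + β) = u ϱ x y)
    (hV : ∀ ϱ ∈ Iio (-N), ∀ x y : ℝ,
      0 < -12 * ϱ + 6 * ϱ ^ 2 * deriv (fun r => u r x y) ϱ)
    (a b : ℝ)
    (hab : ∀ ϱ ∈ Iio (-N),
      (∫ t in (0:ℝ)..1, ∫ s in (0:ℝ)..1, Real.exp (u ϱ (s + t * α) (t * β)) * |β|)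
        = a * ϱ + b) :
    a < 0 ∨ (a = 0 ∧ 0 < b) := by
  refine neg_or_eq_zero_and_pos_of_affine_pos (c := -N) fun ϱ hϱ => ?_
  rw [← hab ϱ hϱ]
  refine intervalIntegral_intervalIntegral_pos
    (f := fun t s => Real.exp (u ϱ (s + t * α) (t * β)) * |β|) ?_
    fun t s => mul_pos (Real.exp_pos _) (abs_pos.mpr hβ)
  have hu : Continuous fun p : ℝ × ℝ => u ϱ (p.2 + p.1 * α) (p.1 * β) :=
    hsmooth.continuousOn.comp_continuous
      (f := fun p : ℝ × ℝ => (ϱ, p.2 + p.1 * α, p.1 * β)) (by fun_prop)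
      fun p => ⟨hϱ, mem_univ _⟩
  exact (Real.continuous_exp.comp hu).mul continuous_const
end

section
/- Let N ≥ 0 and L > 0. Let u : (N, ∞) × [0, L] → ℝ be twice continuously differentiable up to the boundary, satisfying the reduced SU(∞) Toda equation ∂²(e^u)/∂ϱ² + ∂²u/∂x² = 0 on (N, ∞) × [0, L], and satisfying the boundary conditions ∂u/∂x(ϱ, 0) = 2 and ∂u/∂x(ϱ, L) = −2 for every ϱ ∈ (N, ∞). Then there exist constants a, b ∈ ℝ such that for every ϱ ∈ (N, ∞): ∫₀^L e^{u(ϱ, x)} dx = 2ϱ² + aϱ + b, and ∫₀^L (−12ϱ + 6ϱ² ∂u/∂ϱ(ϱ, x)) e^{u(ϱ, x)} dx = −6aϱ² − 12bϱ. -/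
open Set Real

open MeasureTheory Filter Topology

section Strip

variable {N L : ℝ} {g : ℝ × ℝ → ℝ}

theorem uniqueDiffOn_Ioi_prod_Icc (hL : 0 < L) :
    UniqueDiffOn ℝ (Ioi N ×ˢ Icc 0 L) :=
  (uniqueDiffOn_Ioi N).prod (uniqueDiffOn_Icc hL)

/-- The partial derivative in a fixed direction loses one order of regularity on the strip. -/
theorem ContDiffOn.fderivWithin_strip_apply {m n : WithTop ℕ∞} (hL : 0 < L)
    (hg : ContDiffOn ℝ n g (Ioi N ×ˢ Icc 0 L)) (hmn : m + 1 ≤ n) (v : ℝ × ℝ) :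
    ContDiffOn ℝ m (fun p => fderivWithin ℝ g (Ioi N ×ˢ Icc 0 L) p v) (Ioi N ×ˢ Icc 0 L) :=
  (hg.fderivWithin (uniqueDiffOn_Ioi_prod_Icc hL) hmn).clm_apply contDiffOn_const

theorem ContDiffOn.hasDerivAt_strip_fst
    (hg : ContDiffOn ℝ 1 g (Ioi N ×ˢ Icc 0 L)) {r x : ℝ} (hr : r ∈ Ioi N) (hx : x ∈ Icc 0 L) :
    HasDerivAt (fun s => g (s, x)) (fderivWithin ℝ g (Ioi N ×ˢ Icc 0 L) (r, x) (1, 0)) r := by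
  have h := (hg.differentiableOn one_ne_zero (r, x) ⟨hr, hx⟩).hasFDerivWithinAt
  have hc : HasDerivWithinAt (fun s : ℝ => (s, x)) ((1 : ℝ), (0 : ℝ)) (Ioi N) r :=
    ((hasDerivAt_id r).prodMk (hasDerivAt_const r x)).hasDerivWithinAt
  have hmaps : MapsTo (fun s : ℝ => (s, x)) (Ioi N) (Ioi N ×ˢ Icc 0 L) := fun s hs => ⟨hs, hx⟩
  exact (h.comp_hasDerivWithinAt r hc hmaps).hasDerivAt (Ioi_mem_nhds hr)

theorem ContDiffOn.hasDerivWithinAt_strip_snd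
    (hg : ContDiffOn ℝ 1 g (Ioi N ×ˢ Icc 0 L)) {r x : ℝ} (hr : r ∈ Ioi N) (hx : x ∈ Icc 0 L) :
    HasDerivWithinAt (fun s => g (r, s))
      (fderivWithin ℝ g (Ioi N ×ˢ Icc 0 L) (r, x) (0, 1)) (Icc 0 L) x := by
  have h := (hg.differentiableOn one_ne_zero (r, x) ⟨hr, hx⟩).hasFDerivWithinAt
  have hc : HasDerivWithinAt (fun s : ℝ => (r, s)) ((0 : ℝ), (1 : ℝ)) (Icc 0 L) x :=
    ((hasDerivAt_const x r).prodMk (hasDerivAt_id x)).hasDerivWithinAt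
  exact h.comp_hasDerivWithinAt x hc fun s hs => ⟨hr, hs⟩

theorem ContinuousOn.intervalIntegrable_strip (hL : 0 < L)
    (hg : ContinuousOn g (Ioi N ×ˢ Icc 0 L)) {r : ℝ} (hr : r ∈ Ioi N) :
    IntervalIntegrable (fun x => g (r, x)) volume 0 L := by
  apply ContinuousOn.intervalIntegrable
  rw [uIcc_of_le hL.le]
  exact hg.comp (by fun_prop) fun x hx => ⟨hr, hx⟩

/-- Differentiation under the integral over the cross-section of the strip. -/
theorem ContDiffOn.hasDerivAt_integral_strip (hL : 0 < L)
    (hg : ContDiffOn ℝ 1 g (Ioi N ×ˢ Icc 0 L)) {r : ℝ} (hr : r ∈ Ioi N) :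
    HasDerivAt (fun s => ∫ x in (0:ℝ)..L, g (s, x))
      (∫ x in (0:ℝ)..L, fderivWithin ℝ g (Ioi N ×ˢ Icc 0 L) (r, x) (1, 0)) r := by
  have hG : ContinuousOn (fun p => fderivWithin ℝ g (Ioi N ×ˢ Icc 0 L) p (1, 0))
      (Ioi N ×ˢ Icc 0 L) :=
    (hg.fderivWithin_strip_apply (m := 0) hL (by simp) (1, 0)).continuousOn
  obtain ⟨c, hNc, hcr⟩ := exists_between (mem_Ioi.1 hr)
  have hsub : Icc c (r + 1) ×ˢ Icc 0 L ⊆ Ioi N ×ˢ Icc 0 L :=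
    prod_mono_left fun s hs => hNc.trans_le hs.1
  obtain ⟨C, hC⟩ := (isCompact_Icc.prod isCompact_Icc).exists_bound_of_continuousOn (hG.mono hsub)
  have hnhds : Icc c (r + 1) ∈ 𝓝 r := Icc_mem_nhds hcr (by linarith)
  have hmem : ∀ x ∈ uIoc 0 L, x ∈ Icc 0 L := fun x hx => by
    rw [uIoc_of_le hL.le] at hx
    exact Ioc_subset_Icc_self hx
  refine (intervalIntegral.hasDerivAt_integral_of_dominated_loc_of_deriv_le
    (F := fun s x => g (s, x))
    (F' := fun s x => fderivWithin ℝ g (Ioi N ×ˢ Icc 0 L) (s, x) (1, 0))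
    (bound := fun _ => C) hnhds ?_ ?_ ?_ ?_ ?_ ?_).2
  · filter_upwards [Ioi_mem_nhds hr] with s hs
    exact (intervalIntegrable_iff.1
      (hg.continuousOn.intervalIntegrable_strip hL hs)).aestronglyMeasurable
  · exact hg.continuousOn.intervalIntegrable_strip hL hr
  · exact (intervalIntegrable_iff.1 (hG.intervalIntegrable_strip hL hr)).aestronglyMeasurable
  · exact .of_forall fun x hx s hs => hC (s, x) ⟨hs, hmem x hx⟩
  · exact intervalIntegrable_const
  · exact .of_forall fun x hx s hs => hg.hasDerivAt_strip_fst (hNc.trans_le hs.1) (hmem x hx)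

theorem ContDiffOn.integral_strip_fderivWithin_snd (hL : 0 < L)
    (hg : ContDiffOn ℝ 1 g (Ioi N ×ˢ Icc 0 L)) {r : ℝ} (hr : r ∈ Ioi N) :
    ∫ x in (0:ℝ)..L, fderivWithin ℝ g (Ioi N ×ˢ Icc 0 L) (r, x) (0, 1) = g (r, L) - g (r, 0) := by
  have hG : ContinuousOn (fun p => fderivWithin ℝ g (Ioi N ×ˢ Icc 0 L) p (0, 1))
      (Ioi N ×ˢ Icc 0 L) :=
    (hg.fderivWithin_strip_apply (m := 0) hL (by simp) (0, 1)).continuousOn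
  refine intervalIntegral.integral_eq_sub_of_hasDerivAt_of_le (f := fun x => g (r, x)) hL.le
    (hg.continuousOn.comp (by fun_prop) fun x hx => ⟨hr, hx⟩) (fun x hx => ?_)
    (hG.intervalIntegrable_strip hL hr)
  exact (hg.hasDerivWithinAt_strip_snd hr (Ioo_subset_Icc_self hx)).hasDerivAt
    (Icc_mem_nhds hx.1 hx.2)

end Strip

theorem exists_const_of_hasDerivAt_zero_Ioi {N : ℝ} {f : ℝ → ℝ}
    (hf : ∀ r ∈ Ioi N, HasDerivAt f 0 r) : ∃ c, ∀ r ∈ Ioi N, f r = c := by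
  refine isOpen_Ioi.exists_is_const_of_deriv_eq_zero isPreconnected_Ioi
    (fun r hr => (hf r hr).differentiableAt.differentiableWithinAt) fun r hr => (hf r hr).deriv

/-- A function with constant second derivative on a half-line is a quadratic polynomial. -/
theorem exists_quadratic_of_hasDerivAt_Ioi {N k : ℝ} {f f' : ℝ → ℝ}
    (hf : ∀ r ∈ Ioi N, HasDerivAt f (f' r) r) (hf' : ∀ r ∈ Ioi N, HasDerivAt f' (2 * k) r) :
    ∃ a b : ℝ, ∀ r ∈ Ioi N, f r = k * r ^ 2 + a * r + b ∧ f' r = 2 * k * r + a := by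
  obtain ⟨a, ha⟩ := exists_const_of_hasDerivAt_zero_Ioi (N := N)
    (f := fun r => f' r - 2 * k * r) fun r hr => by
      exact ((hf' r hr).sub ((hasDerivAt_id r).const_mul (2 * k))).congr_deriv (by simp)
  obtain ⟨b, hb⟩ := exists_const_of_hasDerivAt_zero_Ioi (N := N)
    (f := fun r => f r - (k * r ^ 2 + a * r)) fun r hr => by
      have h := (hf r hr).sub
        (((hasDerivAt_pow 2 r).const_mul k).add ((hasDerivAt_id r).const_mul a))
      refine h.congr_deriv ?_
      have := ha r hr
      norm_num
      linarith
  exact ⟨a, b, fun r hr => ⟨by linarith [hb r hr], by linarith [ha r hr]⟩⟩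

/-- **Integral formulas for the reduced Toda equation on a strip with boundary slopes `±2`.**
Let `u` be `C²` up to the boundary on `(N, ∞) × [0, L]`, satisfying the reduced
`SU(∞)` Toda equation `∂²(e^u)/∂ϱ² + ∂²u/∂x² = 0` and the boundary conditions
`∂u/∂x(ϱ, 0) = 2`, `∂u/∂x(ϱ, L) = −2`. Then there exist constants `a, b` with
`∫₀ᴸ e^u dx = 2ϱ² + aϱ + b` and
`∫₀ᴸ (−12ϱ + 6ϱ² ∂u/∂ϱ) e^u dx = −6aϱ² − 12bϱ` for all `ϱ ∈ (N, ∞)`. -/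
theorem reduced_toda_strip_integral_formulas
    (N L : ℝ) (hN : 0 ≤ N) (hL : 0 < L) (u : ℝ → ℝ → ℝ)
    (hreg : ContDiffOn ℝ 2 (fun p : ℝ × ℝ => u p.1 p.2) (Ioi N ×ˢ Icc 0 L))
    (htoda : ∀ ϱ ∈ Ioi N, ∀ x ∈ Icc (0:ℝ) L,
      deriv (fun r => deriv (fun r' => Real.exp (u r' x)) r) ϱ
        + derivWithin (fun s => derivWithin (fun s' => u ϱ s') (Icc 0 L) s) (Icc 0 L) x
        = 0)
    (hb0 : ∀ ϱ ∈ Ioi N, derivWithin (fun s => u ϱ s) (Icc (0:ℝ) L) 0 = 2)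
    (hbL : ∀ ϱ ∈ Ioi N, derivWithin (fun s => u ϱ s) (Icc (0:ℝ) L) L = -2) :
    ∃ a b : ℝ, ∀ ϱ ∈ Ioi N,
      (∫ x in (0:ℝ)..L, Real.exp (u ϱ x)) = 2 * ϱ ^ 2 + a * ϱ + b ∧
      (∫ x in (0:ℝ)..L,
          (-12 * ϱ + 6 * ϱ ^ 2 * deriv (fun r => u r x) ϱ) * Real.exp (u ϱ x))
        = -6 * a * ϱ ^ 2 - 12 * b * ϱ := by
  have hu1 : ContDiffOn ℝ 1 (fun p : ℝ × ℝ => u p.1 p.2) (Ioi N ×ˢ Icc 0 L) :=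
    hreg.of_le one_le_two
  have hf2 : ContDiffOn ℝ 2 (fun p : ℝ × ℝ => exp (u p.1 p.2)) (Ioi N ×ˢ Icc 0 L) := hreg.exp
  have hf1 := hf2.of_le one_le_two
  have hfr := hf2.fderivWithin_strip_apply (m := 1) hL (by norm_num) (1, 0)
  have hux := hreg.fderivWithin_strip_apply (m := 1) hL (by norm_num) (0, 1)
  have hux_eq : ∀ r ∈ Ioi N, ∀ x ∈ Icc 0 L, derivWithin (fun s => u r s) (Icc 0 L) x
      = fderivWithin ℝ (fun p : ℝ × ℝ => u p.1 p.2) (Ioi N ×ˢ Icc 0 L) (r, x) (0, 1) :=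
    fun r hr x hx =>
      (hu1.hasDerivWithinAt_strip_snd hr hx).derivWithin (uniqueDiffOn_Icc hL x hx)
  have hpde : ∀ r ∈ Ioi N, ∀ x ∈ Icc 0 L,
      fderivWithin ℝ (fun p => fderivWithin ℝ (fun p : ℝ × ℝ => exp (u p.1 p.2))
        (Ioi N ×ˢ Icc 0 L) p (1, 0)) (Ioi N ×ˢ Icc 0 L) (r, x) (1, 0)
      = -fderivWithin ℝ (fun p => fderivWithin ℝ (fun p : ℝ × ℝ => u p.1 p.2)
        (Ioi N ×ˢ Icc 0 L) p (0, 1)) (Ioi N ×ˢ Icc 0 L) (r, x) (0, 1) := by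
    intro r hr x hx
    have h := htoda r hr x hx
    have heq : (fun s => deriv (fun r' => exp (u r' x)) s) =ᶠ[𝓝 r] fun s =>
        fderivWithin ℝ (fun p : ℝ × ℝ => exp (u p.1 p.2)) (Ioi N ×ˢ Icc 0 L) (s, x) (1, 0) := by
      filter_upwards [Ioi_mem_nhds hr] with s hs
      exact (hf1.hasDerivAt_strip_fst hs hx).deriv
    rw [heq.deriv_eq, (hfr.hasDerivAt_strip_fst hr hx).deriv,
      derivWithin_congr (fun s hs => hux_eq r hr s hs) (hux_eq r hr x hx),
      (hux.hasDerivWithinAt_strip_snd hr hx).derivWithin (uniqueDiffOn_Icc hL x hx)] at h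
    linarith
  obtain ⟨a, b, hab⟩ := exists_quadratic_of_hasDerivAt_Ioi (k := 2)
    (fun r hr => hf1.hasDerivAt_integral_strip hL hr) (fun r hr => by
      refine (hfr.hasDerivAt_integral_strip hL hr).congr_deriv ?_
      rw [intervalIntegral.integral_congr
        (fun x hx => hpde r hr x (by rwa [uIcc_of_le hL.le] at hx)),
        intervalIntegral.integral_neg, hux.integral_strip_fderivWithin_snd hL hr,
        ← hux_eq r hr L (right_mem_Icc.2 hL.le), ← hux_eq r hr 0 (left_mem_Icc.2 hL.le),
        hbL r hr, hb0 r hr]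
      norm_num)
  refine ⟨a, b, fun r hr => ⟨(hab r hr).1, ?_⟩⟩
  have hint : ∀ x ∈ uIcc 0 L,
      (-12 * r + 6 * r ^ 2 * deriv (fun s => u s x) r) * exp (u r x)
      = -12 * r * exp (u r x) + 6 * r ^ 2 * fderivWithin ℝ (fun p : ℝ × ℝ => exp (u p.1 p.2))
        (Ioi N ×ˢ Icc 0 L) (r, x) (1, 0) := by
    intro x hx
    rw [uIcc_of_le hL.le] at hx
    have h := hu1.hasDerivAt_strip_fst hr hx
    rw [(hf1.hasDerivAt_strip_fst hr hx).unique h.exp, h.deriv]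
    ring
  rw [intervalIntegral.integral_congr hint, intervalIntegral.integral_add
    ((hf1.continuousOn.intervalIntegrable_strip hL hr).const_mul _)
    ((hfr.continuousOn.intervalIntegrable_strip hL hr).const_mul _),
    intervalIntegral.integral_const_mul, intervalIntegral.integral_const_mul,
    (hab r hr).1, (hab r hr).2]
  ring
end
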